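/- Let d ∈ ℕ and let W^Q, W^K be d×d random matrices whose entries are i.i.d. standard Gaussian N(0,1), the family of all entries of (W^Q, W^K) being independent. For vectors a, b, x, y ∈ ℝ^d define ξ = aᵀ W^Q (W^K)ᵀ b and ζ = xᵀ W^Q (W^K)ᵀ y. Then Cov(ξ², ζ²) = 2d ( ‖a‖₂²‖x‖₂² (bᵀy)² + (aᵀx)² ‖b‖₂²‖y‖₂² + (d+1)(aᵀx)²(bᵀy)² ). -/

import Mathlib

open MeasureTheory ProbabilityTheory Matrix

open scoped NNReal ENNReal

/-- The fourth moment of a centered real Gaussian of variance `v` is `3 v²`. -/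
lemma integral_pow_four_gaussianReal (v : ℝ≥0) :
    ∫ x, x ^ 4 ∂(gaussianReal 0 v) = 3 * (v : ℝ) ^ 2 := by
  have h := iteratedDeriv_mgf_zero (X := id) (μ := gaussianReal 0 v) (by simp) 4
  rw [mgf_id_gaussianReal] at h
  simp only [Pi.pow_apply, id, zero_mul, zero_add] at h
  rw [← h]
  have hE (t : ℝ) : HasDerivAt (fun t : ℝ => Real.exp (v * t ^ 2 / 2))
      (v * t * Real.exp (v * t ^ 2 / 2)) t := by
    refine (((hasDerivAt_pow 2 t).const_mul (v : ℝ)).div_const 2).exp.congr_deriv ?_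
    push_cast; ring
  have hderiv (p p' : ℝ → ℝ) (hp : ∀ t, HasDerivAt p (p' t) t) :
      deriv (fun t : ℝ => p t * Real.exp (v * t ^ 2 / 2)) =
        fun t => (p' t + p t * (v * t)) * Real.exp (v * t ^ 2 / 2) := by
    ext t
    rw [((hp t).fun_mul (hE t)).deriv]; ring
  have h1 : deriv (fun t : ℝ => Real.exp (v * t ^ 2 / 2)) =
      fun t => (v * t) * Real.exp (v * t ^ 2 / 2) := funext fun t => (hE t).deriv
  have hl (t : ℝ) : HasDerivAt (fun t : ℝ => v * t) (v : ℝ) t := by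
    simpa using (hasDerivAt_id t).const_mul (v : ℝ)
  have hq (t : ℝ) := ((hl t).fun_mul (hl t)).const_add (v : ℝ)
  have h2 := hderiv _ _ hl
  have h3 := hderiv _ _ hq
  have h4 := hderiv _ _ fun t =>
    (((hl t).const_mul (v : ℝ)).fun_add ((hl t).mul_const (v : ℝ))).fun_add ((hq t).fun_mul (hl t))
  simp only [iteratedDeriv_succ, iteratedDeriv_zero, h1, h2, h3]
  have e (t : ℝ) : v * (v * t) = v * t * v := by ring
  simp only [e] at h4 ⊢
  rw [h4]
  norm_num; ring

/-- A finite product of Gaussian measures is Gaussian. -/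
instance isGaussian_pi {ι : Type*} [Fintype ι] {E : ι → Type*} [∀ i, NormedAddCommGroup (E i)]
    [∀ i, NormedSpace ℝ (E i)] [∀ i, MeasurableSpace (E i)] [∀ i, BorelSpace (E i)]
    [∀ i, CompleteSpace (E i)] [∀ i, SecondCountableTopology (E i)]
    (μ : ∀ i, Measure (E i)) [∀ i, IsGaussian (μ i)] : IsGaussian (Measure.pi μ) := by
  have hind : iIndepFun (fun i (w : ∀ i, E i) => w i) (Measure.pi μ) :=
    iIndepFun_pi (X := fun i => (id : E i → E i)) fun i => aemeasurable_id
  have h := hind.hasGaussianLaw fun i => ⟨by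
    rw [(measurePreserving_eval μ i).map_eq]; infer_instance⟩
  have := h.isGaussian_map
  rwa [show (fun (w : ∀ i, E i) i => w i) = id from rfl, Measure.map_id] at this

lemma memLp_mul_of_forall {α : Type*} [MeasurableSpace α] {μ : Measure α} {f g : α → ℝ}
    (hf : ∀ p : ℝ≥0∞, p ≠ ∞ → MemLp f p μ) (hg : ∀ p : ℝ≥0∞, p ≠ ∞ → MemLp g p μ)
    (p : ℝ≥0∞) (hp : p ≠ ∞) : MemLp (fun x => f x * g x) p μ := by
  have : (2 * p).HolderTriple (2 * p) p := ⟨by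
    rw [ENNReal.mul_inv (by simp) (by simp), ← add_mul, ENNReal.inv_two_add_inv_two, one_mul]⟩
  have h2 : 2 * p ≠ ∞ := ENNReal.mul_ne_top (by simp) hp
  exact (hg _ h2).mul (hf _ h2)

section Isserlis

variable {E : Type*} [NormedAddCommGroup E] [NormedSpace ℝ E] [MeasurableSpace E] [BorelSpace E]
  {μ : Measure E} [IsGaussian μ]

lemma integrable_dual_mul (L₁ L₂ : StrongDual ℝ E) : Integrable (fun w => L₁ w * L₂ w) μ :=
  (IsGaussian.memLp_dual μ L₁ 2 (by simp)).integrable_mul (IsGaussian.memLp_dual μ L₂ 2 (by simp))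

lemma integrable_dual_mul_mul_mul (L₁ L₂ L₃ L₄ : StrongDual ℝ E) :
    Integrable (fun w => L₁ w * L₂ w * (L₃ w * L₄ w)) μ :=
  memLp_one_iff_integrable.1 <| memLp_mul_of_forall
    (memLp_mul_of_forall (IsGaussian.memLp_dual μ L₁) (IsGaussian.memLp_dual μ L₂))
    (memLp_mul_of_forall (IsGaussian.memLp_dual μ L₃) (IsGaussian.memLp_dual μ L₄)) 1 (by simp)

lemma integral_dual_pow_four (hμ : ∀ L : StrongDual ℝ E, ∫ w, L w ∂μ = 0) (L : StrongDual ℝ E) :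
    ∫ w, L w ^ 4 ∂μ = 3 * (∫ w, L w * L w ∂μ) ^ 2 := by
  have hmap := IsGaussian.map_eq_gaussianReal (μ := μ) L
  have hvar : Var[L; μ] = ∫ w, L w * L w ∂μ := by
    rw [variance_eq_sub (IsGaussian.memLp_dual μ L 2 (by simp)), hμ]
    simp [pow_two]
  have h := integral_pow_four_gaussianReal Var[L; μ].toNNReal
  rw [hμ L] at hmap
  rw [← hmap, integral_map (by fun_prop) (by fun_prop), Real.coe_toNNReal _ (variance_nonneg _ _),
    hvar] at h
  exact h

/-- Isserlis' theorem for four continuous linear functionals of a centered Gaussian measure. -/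
lemma integral_dual_mul_mul_mul (hμ : ∀ L : StrongDual ℝ E, ∫ w, L w ∂μ = 0)
    (L₁ L₂ L₃ L₄ : StrongDual ℝ E) :
    ∫ w, L₁ w * L₂ w * (L₃ w * L₄ w) ∂μ =
      (∫ w, L₁ w * L₂ w ∂μ) * (∫ w, L₃ w * L₄ w ∂μ) +
      (∫ w, L₁ w * L₃ w ∂μ) * (∫ w, L₂ w * L₄ w ∂μ) +
      (∫ w, L₁ w * L₄ w ∂μ) * (∫ w, L₂ w * L₃ w ∂μ) := by
  let B : StrongDual ℝ E → StrongDual ℝ E → ℝ := fun L M => ∫ w, L w * M w ∂μ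
  have hadd (L M N : StrongDual ℝ E) : B (L + M) N = B L N + B M N := by
    simp only [B, _root_.add_apply, add_mul]
    exact integral_add (integrable_dual_mul _ _) (integrable_dual_mul _ _)
  have hsub (L M N : StrongDual ℝ E) : B (L - M) N = B L N - B M N := by
    simp only [B, _root_.sub_apply, sub_mul]
    exact integral_sub (integrable_dual_mul _ _) (integrable_dual_mul _ _)
  have hcomm (L M : StrongDual ℝ E) : B L M = B M L := by simp only [B, mul_comm]
  have hint (L : StrongDual ℝ E) : Integrable (fun w => L w ^ 4) μ := by
    refine (integrable_dual_mul_mul_mul L L L L).congr (.of_forall fun w => ?_)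
    ring
  have hpow (L : StrongDual ℝ E) : ∫ w, L w ^ 4 ∂μ = 3 * B L L ^ 2 := integral_dual_pow_four hμ L
  have hpol : ∫ w, L₁ w * L₂ w * (L₃ w * L₄ w) ∂μ = (1 / 192) *
      ((∫ w, (L₁ + L₂ + L₃ + L₄) w ^ 4 ∂μ) - (∫ w, (L₁ + L₂ + L₃ - L₄) w ^ 4 ∂μ)
      - (∫ w, (L₁ + L₂ - L₃ + L₄) w ^ 4 ∂μ) + (∫ w, (L₁ + L₂ - L₃ - L₄) w ^ 4 ∂μ)
      - (∫ w, (L₁ - L₂ + L₃ + L₄) w ^ 4 ∂μ) + (∫ w, (L₁ - L₂ + L₃ - L₄) w ^ 4 ∂μ)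
      + (∫ w, (L₁ - L₂ - L₃ + L₄) w ^ 4 ∂μ) - (∫ w, (L₁ - L₂ - L₃ - L₄) w ^ 4 ∂μ)) := by
    rw [← integral_sub, ← integral_sub, ← integral_add, ← integral_sub, ← integral_add,
      ← integral_add, ← integral_sub, ← integral_const_mul]
    · congr 1 with w
      simp only [_root_.add_apply, _root_.sub_apply]
      ring
    all_goals fun_prop (disch := exact hint _)
  rw [hpol]
  simp only [hpow]
  have hadd' (L M N : StrongDual ℝ E) : B N (L + M) = B N L + B N M := by
    rw [hcomm, hadd, hcomm L, hcomm M]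
  have hsub' (L M N : StrongDual ℝ E) : B N (L - M) = B N L - B N M := by
    rw [hcomm, hsub, hcomm L, hcomm M]
  change _ = B L₁ L₂ * B L₃ L₄ + B L₁ L₃ * B L₂ L₄ + B L₁ L₄ * B L₂ L₃
  simp only [hadd, hsub, hadd', hsub', hcomm L₂ L₁, hcomm L₃ L₁, hcomm L₄ L₁, hcomm L₃ L₂,
    hcomm L₄ L₂, hcomm L₄ L₃]
  ring

end Isserlis

/-- The law of a `d × d` matrix with independent standard Gaussian entries. -/
noncomputable abbrev gaussianMatrix (d : ℕ) : Measure (Fin d → Fin d → ℝ) :=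
  Measure.pi fun _ => Measure.pi fun _ => gaussianReal 0 1

/-- The linear functional `W ↦ bᵀ W c`. -/
noncomputable def bilinEval {d : ℕ} (b c : Fin d → ℝ) : StrongDual ℝ (Fin d → Fin d → ℝ) :=
  ∑ k, ∑ j, (b k * c j) •
    (ContinuousLinearMap.proj (R := ℝ) (φ := fun _ : Fin d => ℝ) j ∘L
      ContinuousLinearMap.proj (R := ℝ) (φ := fun _ : Fin d => Fin d → ℝ) k)

lemma bilinEval_apply {d : ℕ} (b c : Fin d → ℝ) (W : Fin d → Fin d → ℝ) :
    bilinEval b c W = ∑ k, ∑ j, b k * c j * W k j := by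
  simp [bilinEval]

lemma integral_mul_pi {ι : Type*} [Fintype ι] [DecidableEq ι] {X : Type*} [MeasurableSpace X]
    (ν : Measure X) [IsProbabilityMeasure ν] {f g : X → ℝ} (hf : Measurable f) (hg : Measurable g)
    (hf0 : ∫ x, f x ∂ν = 0) (i k : ι) :
    ∫ w, f (w i) * g (w k) ∂(Measure.pi fun _ : ι => ν) =
      if i = k then ∫ x, f x * g x ∂ν else 0 := by
  split_ifs with h
  · subst h
    exact integral_comp_eval (μ := fun _ : ι => ν) (f := fun x => f x * g x)
      (by fun_prop)
  · have hind : iIndepFun (fun (i : ι) (w : ι → X) => w i) (Measure.pi fun _ => ν) :=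
      iIndepFun_pi (X := fun _ => (id : X → X)) fun i => aemeasurable_id
    refine (((hind.indepFun h).comp hf hg).integral_fun_mul_eq_mul_integral
      (hf.comp (measurable_pi_apply i)).aestronglyMeasurable
      (hg.comp (measurable_pi_apply k)).aestronglyMeasurable).trans ?_
    have := integral_comp_eval (μ := fun _ : ι => ν) (i := i) (f := f) (by fun_prop)
    simp only [Function.comp_apply]
    rw [this, hf0, zero_mul]

lemma integral_entry_mul_entry {d : ℕ} (i j k l : Fin d) :
    ∫ W, W i j * W k l ∂(gaussianMatrix d) = if i = k then if j = l then 1 else 0 else 0 := by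
  have h2 : ∫ x : ℝ, x * x ∂(gaussianReal 0 1) = 1 := by
    have := variance_fun_id_gaussianReal (μ := 0) (v := 1)
    rw [variance_eq_sub (X := fun x => x) (memLp_id_gaussianReal' 2 (by simp))] at this
    simpa [pow_two] using this
  rw [integral_mul_pi (f := fun r : Fin d → ℝ => r j) (g := fun r : Fin d → ℝ => r l) _
    (by fun_prop) (by fun_prop)]
  · congr 1
    rw [integral_mul_pi (f := fun r : ℝ => r) (g := fun r : ℝ => r) _
      (by fun_prop) (by fun_prop) (by simp), h2]
  · rw [integral_comp_eval (μ := fun _ : Fin d => gaussianReal 0 1) (i := j) (f := fun r : ℝ => r)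
      (by fun_prop)]
    simp

lemma integral_entry {d : ℕ} (i j : Fin d) : ∫ W, W i j ∂(gaussianMatrix d) = 0 := by
  rw [integral_comp_eval (μ := fun _ : Fin d => Measure.pi fun _ : Fin d => gaussianReal 0 1)
    (i := i) (f := fun r : Fin d → ℝ => r j)
      (measurable_pi_apply j).aestronglyMeasurable,
    integral_comp_eval (μ := fun _ : Fin d => gaussianReal 0 1) (i := j) (f := fun r : ℝ => r)
      (by fun_prop)]
  simp

lemma integral_dual_gaussianMatrix {d : ℕ} (L : StrongDual ℝ (Fin d → Fin d → ℝ)) :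
    ∫ W, L W ∂(gaussianMatrix d) = 0 := by
  have hid : Integrable (fun W => W) (gaussianMatrix d) := IsGaussian.integrable_id
  rw [L.integral_comp_comm hid]
  suffices ∫ W, W ∂(gaussianMatrix d) = 0 by rw [this, map_zero]
  ext i j
  have h1 := eval_integral (μ := gaussianMatrix d) (f := fun W => W) (fun i => hid.eval i) i
  have h2 := eval_integral (μ := gaussianMatrix d) (f := fun W => W i)
    (fun j => (hid.eval i).eval j) j
  rw [h1, h2, integral_entry]
  rfl

lemma integral_bilinEval_mul_bilinEval {d : ℕ} (a b x y : Fin d → ℝ) :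
    ∫ W, bilinEval a b W * bilinEval x y W ∂(gaussianMatrix d) = (a ⬝ᵥ x) * (b ⬝ᵥ y) := by
  have hint (i j k l : Fin d) : Integrable (fun W => W i j * W k l) (gaussianMatrix d) := by
    have := integrable_dual_mul (μ := gaussianMatrix d) (bilinEval (Pi.single i 1) (Pi.single j 1))
      (bilinEval (Pi.single k 1) (Pi.single l 1))
    simpa [bilinEval_apply, Pi.single_apply] using this
  have h (W : Fin d → Fin d → ℝ) : bilinEval a b W * bilinEval x y W =
      ∑ i, ∑ j, ∑ k, ∑ l, (a i * b j * (x k * y l)) * (W i j * W k l) := by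
    simp only [bilinEval_apply, Finset.sum_mul]
    simp only [Finset.mul_sum]
    refine Finset.sum_congr rfl fun i _ => Finset.sum_congr rfl fun j _ =>
      Finset.sum_congr rfl fun k _ => Finset.sum_congr rfl fun l _ => by ring
  simp only [h]
  have hint' (i j k l : Fin d) := (hint i j k l).const_mul (a i * b j * (x k * y l))
  rw [integral_finsetSum _ fun i _ => integrable_finsetSum _ fun j _ => integrable_finsetSum _
    fun k _ => integrable_finsetSum _ fun l _ => hint' i j k l]
  simp_rw [integral_finsetSum _ fun j _ => integrable_finsetSum _
    fun k _ => integrable_finsetSum _ fun l _ => hint' _ j k l,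
    integral_finsetSum _ fun k _ => integrable_finsetSum _ fun l _ => hint' _ _ k l,
    integral_finsetSum _ fun l _ => hint' _ _ _ l, integral_const_mul, integral_entry_mul_entry]
  simp only [mul_ite, mul_one, mul_zero, Finset.sum_ite_eq, Finset.mem_univ, if_true,
    Finset.sum_ite_irrel, Finset.sum_const_zero, dotProduct, Finset.sum_mul_sum]
  refine Finset.sum_congr rfl fun i _ => Finset.sum_congr rfl fun j _ => by ring

section Moments

variable {d : ℕ}

lemma vecMul_eq_bilinEval (a : Fin d → ℝ) (W : Fin d → Fin d → ℝ) (j : Fin d) :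
    (a ᵥ* Matrix.of W) j = bilinEval a (Pi.single j 1) W := by
  simp [bilinEval_apply, vecMul, dotProduct, Pi.single_apply]

lemma dotProduct_mul_transpose_mulVec (a b : Fin d → ℝ) (Q K : Fin d → Fin d → ℝ) :
    a ⬝ᵥ (Matrix.of Q * (Matrix.of K)ᵀ) *ᵥ b = (a ᵥ* Matrix.of Q) ⬝ᵥ (b ᵥ* Matrix.of K) := by
  rw [← mulVec_mulVec, dotProduct_mulVec, mulVec_transpose]

lemma vecMul_dotProduct_vecMul (a b : Fin d → ℝ) (Q K : Fin d → Fin d → ℝ) :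
    (a ᵥ* Matrix.of Q) ⬝ᵥ (b ᵥ* Matrix.of K) = bilinEval b (a ᵥ* Matrix.of Q) K := by
  rw [bilinEval_apply, Finset.sum_comm]
  refine Finset.sum_congr rfl fun j _ => ?_
  change _ * ∑ k, b k * K k j = _
  rw [Finset.mul_sum]
  exact Finset.sum_congr rfl fun k _ => by ring

lemma single_dotProduct_single (j k : Fin d) :
    (Pi.single j 1 : Fin d → ℝ) ⬝ᵥ Pi.single k 1 = if j = k then 1 else 0 := by
  simp [Pi.single_apply, eq_comm]

lemma integrable_vecMul_mul_vecMul (a x : Fin d → ℝ) (j k : Fin d) :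
    Integrable (fun W => (a ᵥ* Matrix.of W) j * (x ᵥ* Matrix.of W) k) (gaussianMatrix d) := by
  simp only [vecMul_eq_bilinEval]
  exact integrable_dual_mul _ _

lemma integrable_vecMul_mul_mul_mul (a b x y : Fin d → ℝ) (i j k l : Fin d) :
    Integrable (fun W => (a ᵥ* Matrix.of W) i * (b ᵥ* Matrix.of W) j *
      ((x ᵥ* Matrix.of W) k * (y ᵥ* Matrix.of W) l)) (gaussianMatrix d) := by
  simp only [vecMul_eq_bilinEval]
  exact integrable_dual_mul_mul_mul _ _ _ _

lemma integral_vecMul_dotProduct_vecMul (a x : Fin d → ℝ) :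
    ∫ W, (a ᵥ* Matrix.of W) ⬝ᵥ (x ᵥ* Matrix.of W) ∂(gaussianMatrix d) = d * (a ⬝ᵥ x) := by
  simp only [dotProduct.eq_1 (_ ᵥ* _)]
  rw [integral_finsetSum _ fun j _ => integrable_vecMul_mul_vecMul a x j j]
  simp [vecMul_eq_bilinEval, integral_bilinEval_mul_bilinEval]

lemma integrable_vecMul_dotProduct_mul_dotProduct (a b x y : Fin d → ℝ) :
    Integrable (fun W => ((a ᵥ* Matrix.of W) ⬝ᵥ (b ᵥ* Matrix.of W)) *
      ((x ᵥ* Matrix.of W) ⬝ᵥ (y ᵥ* Matrix.of W))) (gaussianMatrix d) := by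
  simp only [dotProduct, Finset.sum_mul_sum]
  exact integrable_finsetSum _ fun j _ => integrable_finsetSum _ fun k _ =>
    integrable_vecMul_mul_mul_mul a b x y j j k k

lemma integral_vecMul_dotProduct_mul_dotProduct (a b x y : Fin d → ℝ) :
    ∫ W, ((a ᵥ* Matrix.of W) ⬝ᵥ (b ᵥ* Matrix.of W)) *
        ((x ᵥ* Matrix.of W) ⬝ᵥ (y ᵥ* Matrix.of W)) ∂(gaussianMatrix d) =
      d ^ 2 * ((a ⬝ᵥ b) * (x ⬝ᵥ y)) +
        d * ((a ⬝ᵥ x) * (b ⬝ᵥ y)) + d * ((a ⬝ᵥ y) * (b ⬝ᵥ x)) := by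
  simp only [dotProduct.eq_1 (_ ᵥ* _), Finset.sum_mul_sum]
  rw [integral_finsetSum _ fun j _ => integrable_finsetSum _ fun k _ =>
    integrable_vecMul_mul_mul_mul a b x y j j k k]
  simp_rw [integral_finsetSum _ fun k _ => integrable_vecMul_mul_mul_mul a b x y _ _ k k,
    vecMul_eq_bilinEval, integral_dual_mul_mul_mul integral_dual_gaussianMatrix,
    integral_bilinEval_mul_bilinEval, single_dotProduct_single]
  simp [Finset.sum_add_distrib]
  ring

lemma integral_sq_vecMul_dotProduct (a b : Fin d → ℝ) (Q : Fin d → Fin d → ℝ) :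
    ∫ K, ((a ᵥ* Matrix.of Q) ⬝ᵥ (b ᵥ* Matrix.of K)) ^ 2 ∂(gaussianMatrix d) =
      (b ⬝ᵥ b) * ((a ᵥ* Matrix.of Q) ⬝ᵥ (a ᵥ* Matrix.of Q)) := by
  simp only [vecMul_dotProduct_vecMul a b, pow_two, integral_bilinEval_mul_bilinEval]

lemma integral_sq_mul_sq_vecMul_dotProduct (a b x y : Fin d → ℝ) (Q : Fin d → Fin d → ℝ) :
    ∫ K, ((a ᵥ* Matrix.of Q) ⬝ᵥ (b ᵥ* Matrix.of K)) ^ 2 *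
        ((x ᵥ* Matrix.of Q) ⬝ᵥ (y ᵥ* Matrix.of K)) ^ 2 ∂(gaussianMatrix d) =
      (b ⬝ᵥ b) * (y ⬝ᵥ y) * (((a ᵥ* Matrix.of Q) ⬝ᵥ (a ᵥ* Matrix.of Q)) *
        ((x ᵥ* Matrix.of Q) ⬝ᵥ (x ᵥ* Matrix.of Q))) +
      2 * (b ⬝ᵥ y) ^ 2 * (((a ᵥ* Matrix.of Q) ⬝ᵥ (x ᵥ* Matrix.of Q)) *
        ((a ᵥ* Matrix.of Q) ⬝ᵥ (x ᵥ* Matrix.of Q))) := by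
  simp only [vecMul_dotProduct_vecMul a b, vecMul_dotProduct_vecMul x y, pow_two,
    integral_dual_mul_mul_mul integral_dual_gaussianMatrix, integral_bilinEval_mul_bilinEval]
  ring

lemma memLp_vecMul_dotProduct_vecMul (a b : Fin d → ℝ) (p : ℝ≥0∞) (hp : p ≠ ∞) :
    MemLp (fun w : (Fin d → Fin d → ℝ) × (Fin d → Fin d → ℝ) =>
      (a ᵥ* Matrix.of w.1) ⬝ᵥ (b ᵥ* Matrix.of w.2)) p
      ((gaussianMatrix d).prod (gaussianMatrix d)) := by
  simp only [dotProduct.eq_1 (_ ᵥ* _), vecMul_eq_bilinEval]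
  exact memLp_finsetSum _ fun j _ => memLp_mul_of_forall
    (fun q hq => (IsGaussian.memLp_dual _ (bilinEval a (Pi.single j 1)) q hq).comp_fst _)
    (fun q hq => (IsGaussian.memLp_dual _ (bilinEval b (Pi.single j 1)) q hq).comp_snd _) p hp

lemma integral_prod_sq_vecMul_dotProduct (a b : Fin d → ℝ) :
    ∫ w : (Fin d → Fin d → ℝ) × (Fin d → Fin d → ℝ),
        ((a ᵥ* Matrix.of w.1) ⬝ᵥ (b ᵥ* Matrix.of w.2)) ^ 2
        ∂((gaussianMatrix d).prod (gaussianMatrix d)) = d * ((a ⬝ᵥ a) * (b ⬝ᵥ b)) := by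
  rw [integral_prod _ (memLp_vecMul_dotProduct_vecMul a b 2 (by simp)).integrable_sq]
  simp only [integral_sq_vecMul_dotProduct]
  rw [integral_const_mul, integral_vecMul_dotProduct_vecMul]
  ring

lemma integral_prod_sq_mul_sq_vecMul_dotProduct (a b x y : Fin d → ℝ) :
    ∫ w : (Fin d → Fin d → ℝ) × (Fin d → Fin d → ℝ),
        ((a ᵥ* Matrix.of w.1) ⬝ᵥ (b ᵥ* Matrix.of w.2)) ^ 2 *
          ((x ᵥ* Matrix.of w.1) ⬝ᵥ (y ᵥ* Matrix.of w.2)) ^ 2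
        ∂((gaussianMatrix d).prod (gaussianMatrix d)) =
      (b ⬝ᵥ b) * (y ⬝ᵥ y) * (d ^ 2 * ((a ⬝ᵥ a) * (x ⬝ᵥ x)) + 2 * d * (a ⬝ᵥ x) ^ 2) +
      2 * (b ⬝ᵥ y) ^ 2 *
        (d ^ 2 * (a ⬝ᵥ x) ^ 2 + d * ((a ⬝ᵥ a) * (x ⬝ᵥ x)) + d * (a ⬝ᵥ x) ^ 2) := by
  have hint : Integrable (fun w : (Fin d → Fin d → ℝ) × (Fin d → Fin d → ℝ) =>
      ((a ᵥ* Matrix.of w.1) ⬝ᵥ (b ᵥ* Matrix.of w.2)) ^ 2 *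
        ((x ᵥ* Matrix.of w.1) ⬝ᵥ (y ᵥ* Matrix.of w.2)) ^ 2)
      ((gaussianMatrix d).prod (gaussianMatrix d)) := by
    simp only [pow_two]
    have h₁ := memLp_vecMul_dotProduct_vecMul a b
    have h₂ := memLp_vecMul_dotProduct_vecMul x y
    exact memLp_one_iff_integrable.1 <|
      memLp_mul_of_forall (memLp_mul_of_forall h₁ h₁) (memLp_mul_of_forall h₂ h₂) 1 (by simp)
  rw [integral_prod _ hint]
  simp only [integral_sq_mul_sq_vecMul_dotProduct]
  rw [integral_add, integral_const_mul, integral_const_mul,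
    integral_vecMul_dotProduct_mul_dotProduct, integral_vecMul_dotProduct_mul_dotProduct,
    dotProduct_comm x a]
  · ring
  all_goals exact (integrable_vecMul_dotProduct_mul_dotProduct _ _ _ _).const_mul _

end Moments

/-- For `d × d` random matrices `W^Q, W^K` with i.i.d. standard Gaussian
entries (the family of all entries being independent), and vectors `a, b, x, y ∈ ℝ^d`,
setting `ξ = aᵀ W^Q (W^K)ᵀ b` and `ζ = xᵀ W^Q (W^K)ᵀ y`, we have
`Cov(ξ², ζ²) = 2d (‖a‖²‖x‖²(bᵀy)² + (aᵀx)²‖b‖²‖y‖² + (d+1)(aᵀx)²(bᵀy)²)`. -/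
theorem stmt0 (d : ℕ) {Ω : Type*} [MeasurableSpace Ω] (P : Measure Ω)
    [IsProbabilityMeasure P]
    (WQ WK : Ω → Fin d → Fin d → ℝ)
    (hlaw : Measure.map (fun ω => (WQ ω, WK ω)) P =
      (Measure.pi fun _ : Fin d => Measure.pi fun _ : Fin d => gaussianReal 0 1).prod
        (Measure.pi fun _ : Fin d => Measure.pi fun _ : Fin d => gaussianReal 0 1))
    (a b x y : Fin d → ℝ) :
    (∫ ω, (a ⬝ᵥ (Matrix.of (WQ ω) * (Matrix.of (WK ω))ᵀ).mulVec b) ^ 2 *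
          (x ⬝ᵥ (Matrix.of (WQ ω) * (Matrix.of (WK ω))ᵀ).mulVec y) ^ 2 ∂P) -
      (∫ ω, (a ⬝ᵥ (Matrix.of (WQ ω) * (Matrix.of (WK ω))ᵀ).mulVec b) ^ 2 ∂P) *
        (∫ ω, (x ⬝ᵥ (Matrix.of (WQ ω) * (Matrix.of (WK ω))ᵀ).mulVec y) ^ 2 ∂P) =
    2 * d * ((a ⬝ᵥ a) * (x ⬝ᵥ x) * (b ⬝ᵥ y) ^ 2 + (a ⬝ᵥ x) ^ 2 * (b ⬝ᵥ b) * (y ⬝ᵥ y) +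
      (d + 1) * (a ⬝ᵥ x) ^ 2 * (b ⬝ᵥ y) ^ 2) := by
  have hmeas : AEMeasurable (fun ω => (WQ ω, WK ω)) P := by
    refine AEMeasurable.of_map_ne_zero ?_
    rw [hlaw]
    exact IsProbabilityMeasure.ne_zero _
  have htransfer (f : (Fin d → Fin d → ℝ) × (Fin d → Fin d → ℝ) → ℝ) (hf : Measurable f) :
      ∫ ω, f (WQ ω, WK ω) ∂P = ∫ w, f w ∂((gaussianMatrix d).prod (gaussianMatrix d)) := by
    rw [← hlaw, integral_map hmeas hf.aestronglyMeasurable]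
  have hform (a b : Fin d → ℝ) : Measurable
      fun w : (Fin d → Fin d → ℝ) × (Fin d → Fin d → ℝ) =>
        (a ᵥ* Matrix.of w.1) ⬝ᵥ (b ᵥ* Matrix.of w.2) := by
    simp only [dotProduct, vecMul, Matrix.of_apply]
    fun_prop
  simp only [dotProduct_mul_transpose_mulVec]
  rw [htransfer _ (((hform a b).pow_const 2).fun_mul ((hform x y).pow_const 2)),
    htransfer _ ((hform a b).pow_const 2), htransfer _ ((hform x y).pow_const 2)]
  rw [integral_prod_sq_mul_sq_vecMul_dotProduct, integral_prod_sq_vecMul_dotProduct,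
    integral_prod_sq_vecMul_dotProduct]
  ring
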